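/- Let n be an ℕ-valued random variable with E[n] > 0 that is sub-Weibull with tail parameter θ > 0, i.e. there exist a, b > 0 with P(n ≥ x) ≤ a·exp(−b·x^{1/θ}) for all x ≥ 0. Then there exists a constant L > 1, independent of q, such that for every integer q ≥ 2 the normalized factorial moment satisfies F_q := E[n(n−1)⋯(n−q+1)]/E[n]^q ≤ L^{θ·q·ln q}/E[n]^q. -/

import Mathlib

open MeasureTheory

/-- A nonnegative function of an `ℕ`-valued random variable has expectation at most `∑' k, g k`
whenever `g` dominates its contributions on the level sets. -/
lemma integral_comp_nat_le_tsum {Ω : Type*} [MeasurableSpace Ω] (μ : Measure Ω)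
    [IsFiniteMeasure μ] {n : Ω → ℕ} (hn : Measurable n) {f g : ℕ → ℝ} (hf : ∀ k, 0 ≤ f k)
    (hfg : ∀ k, f k * (μ {ω | n ω = k}).toReal ≤ g k) (hg : Summable g) :
    ∫ ω, f (n ω) ∂μ ≤ ∑' k, g k := by
  have hg0 : ∀ k, 0 ≤ g k := fun k =>
    (mul_nonneg (hf k) ENNReal.toReal_nonneg).trans (hfg k)
  rw [integral_eq_lintegral_of_nonneg_ae (Filter.Eventually.of_forall fun ω => hf (n ω))
    ((measurable_from_nat (f := f)).comp hn).aestronglyMeasurable]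
  refine ENNReal.toReal_le_of_le_ofReal (tsum_nonneg hg0) ?_
  rw [← lintegral_map (f := fun k => ENNReal.ofReal (f k)) measurable_from_nat hn,
    lintegral_countable', ENNReal.ofReal_tsum_of_nonneg hg0 hg]
  refine ENNReal.tsum_le_tsum fun k => ?_
  rw [Measure.map_apply hn (measurableSet_singleton k)]
  refine le_trans (le_of_eq ?_) (ENNReal.ofReal_le_ofReal (hfg k))
  rw [ENNReal.ofReal_mul (hf k), ENNReal.ofReal_toReal (measure_ne_top _ _)]
  rfl

lemma rpow_le_div_rpow_mul_exp {c p y : ℝ} (hc : 0 < c) (hp : 0 < p) (hy : 0 ≤ y) :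
    y ^ p ≤ (p / c) ^ p * Real.exp (c * y) := by
  have h1 : y ≤ p / c * Real.exp (c * y / p) := by
    have h2 : c * y / p ≤ Real.exp (c * y / p) := by
      linarith [Real.add_one_le_exp (c * y / p)]
    calc y = p / c * (c * y / p) := by field_simp
      _ ≤ _ := by gcongr
  calc y ^ p ≤ (p / c * Real.exp (c * y / p)) ^ p := by gcongr
    _ = _ := by
      rw [Real.mul_rpow (by positivity) (by positivity), ← Real.exp_mul,
        div_mul_cancel₀ _ hp.ne']

lemma natCast_pow_le_rpow_mul_exp {c θ : ℝ} (hc : 0 < c) (hθ : 0 < θ) (k : ℕ) {q : ℕ}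
    (hq : 0 < q) :
    (k : ℝ) ^ q ≤ (θ * q / c) ^ (θ * q) * Real.exp (c * (k : ℝ) ^ (1 / θ)) := by
  have hq' : (0 : ℝ) < q := by exact_mod_cast hq
  refine le_trans (le_of_eq ?_) (rpow_le_div_rpow_mul_exp (y := (k : ℝ) ^ (1 / θ)) hc
    (mul_pos hθ hq') (by positivity))
  rw [← Real.rpow_mul (by positivity), ← Real.rpow_natCast]
  congr 1
  field_simp

lemma summable_exp_neg_mul_natCast_rpow {c θ : ℝ} (hc : 0 < c) (hθ : 0 < θ) :
    Summable fun k : ℕ => Real.exp (-(c * (k : ℝ) ^ (1 / θ))) := by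
  have hs : Summable fun k : ℕ => (θ * (2 : ℕ) / c) ^ (θ * (2 : ℕ)) * (1 / (k : ℝ) ^ 2) :=
    (Real.summable_one_div_nat_pow.2 one_lt_two).mul_left _
  rw [← summable_nat_add_iff 1] at hs ⊢
  refine Summable.of_nonneg_of_le (fun k => (Real.exp_pos _).le) (fun k => ?_) hs
  have h := natCast_pow_le_rpow_mul_exp hc hθ (k + 1) two_pos
  have hk : (0 : ℝ) < ((k + 1 : ℕ) : ℝ) ^ 2 := by positivity
  rw [mul_one_div, Real.exp_neg, le_div_iff₀ hk, inv_mul_le_iff₀ (Real.exp_pos _), mul_comm]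
  exact h

/-- The growth `K (r q)^{θ q}` is absorbed by `L^{θ q ln q}` for `L` large, uniformly in
`q ≥ 2`. -/
lemma exists_rpow_mul_le_rpow_log {θ r K : ℝ} (hθ : 0 < θ) (hr : 0 < r) (hK : 0 ≤ K) :
    ∃ L : ℝ, 1 < L ∧ ∀ q : ℕ, 2 ≤ q →
      (r * q) ^ (θ * q) * K ≤ L ^ (θ * q * Real.log q) := by
  have hl2 : 0 < Real.log 2 := Real.log_pos one_lt_two
  set D := |Real.log r| / Real.log 2 with hD
  set E := K / (2 * θ * Real.log 2) with hE
  have hD0 : 0 ≤ D := by positivity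
  have hE0 : 0 ≤ E := by positivity
  refine ⟨Real.exp (1 + D + E), Real.one_lt_exp_iff.2 (by positivity), fun q hq => ?_⟩
  have hq2 : (2 : ℝ) ≤ q := by exact_mod_cast hq
  have hq0 : (0 : ℝ) < q := by linarith
  have hlq : Real.log 2 ≤ Real.log q := Real.log_le_log two_pos hq2
  have hDq : Real.log r ≤ D * Real.log q :=
    calc Real.log r ≤ D * Real.log 2 := by
          rw [hD, div_mul_cancel₀ _ hl2.ne']; exact le_abs_self _
      _ ≤ D * Real.log q := by gcongr
  have hEq : K ≤ E * (θ * q * Real.log q) :=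
    calc K = E * (θ * 2 * Real.log 2) := by rw [hE]; field_simp
      _ ≤ E * (θ * q * Real.log q) := by gcongr
  have hKexp : K ≤ Real.exp K := by linarith [Real.add_one_le_exp K]
  calc (r * q) ^ (θ * q) * K ≤ (r * q) ^ (θ * q) * Real.exp K := by gcongr
    _ = Real.exp (θ * q * (Real.log r + Real.log q) + K) := by
      rw [Real.rpow_def_of_pos (by positivity), Real.log_mul hr.ne' hq0.ne', ← Real.exp_add,
        mul_comm (θ * (q : ℝ))]
    _ ≤ Real.exp ((1 + D + E) * (θ * q * Real.log q)) := by
      refine Real.exp_le_exp.2 ?_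
      have := mul_le_mul_of_nonneg_left hDq (by positivity : 0 ≤ θ * (q : ℝ))
      linarith
    _ = _ := Real.exp_mul _ _

/-- If an `ℕ`-valued random variable `n` with `E[n] > 0` is
sub-Weibull with tail parameter `θ > 0`, then there is a constant `L > 1`,
independent of `q`, such that for every integer `q ≥ 2` the normalized
factorial moment satisfies
`F_q = E[n(n−1)⋯(n−q+1)]/E[n]^q ≤ L^(θ·q·ln q)/E[n]^q`. -/
theorem subWeibull_factorialMoment_bound
    {Ω : Type*} [MeasurableSpace Ω] (μ : Measure Ω) [IsProbabilityMeasure μ]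
    (n : Ω → ℕ) (hn : Measurable n) (θ a b : ℝ)
    (hθ : 0 < θ) (ha : 0 < a) (hb : 0 < b)
    (hmean : 0 < ∫ ω, (n ω : ℝ) ∂μ)
    (htail : ∀ x : ℝ, 0 ≤ x →
      (μ {ω | x ≤ (n ω : ℝ)}).toReal ≤ a * Real.exp (-b * x ^ (1 / θ))) :
    ∃ L : ℝ, 1 < L ∧ ∀ q : ℕ, 2 ≤ q →
      (∫ ω, ((n ω).descFactorial q : ℝ) ∂μ) / (∫ ω, (n ω : ℝ) ∂μ) ^ q ≤
        L ^ (θ * q * Real.log q) / (∫ ω, (n ω : ℝ) ∂μ) ^ q := by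
  have hc : 0 < b / 2 := half_pos hb
  have hs := (summable_exp_neg_mul_natCast_rpow hc hθ).mul_left a
  set K := ∑' k : ℕ, a * Real.exp (-(b / 2 * (k : ℝ) ^ (1 / θ)))
  have hK : 0 ≤ K := tsum_nonneg fun k => by positivity
  obtain ⟨L, hL, hLq⟩ := exists_rpow_mul_le_rpow_log hθ (div_pos hθ hc) hK
  refine ⟨L, hL, fun q hq => ?_⟩
  gcongr
  refine le_trans ?_ (hLq q hq)
  rw [← tsum_mul_left]
  refine integral_comp_nat_le_tsum μ hn (f := fun k => (k.descFactorial q : ℝ))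
    (fun k => by positivity) (fun k => ?_) (hs.mul_left _)
  have hprob : (μ {ω | n ω = k}).toReal ≤ a * Real.exp (-b * (k : ℝ) ^ (1 / θ)) := by
    refine le_trans (ENNReal.toReal_mono (measure_ne_top _ _) (measure_mono fun ω hω => ?_))
      (htail k k.cast_nonneg)
    exact_mod_cast (Eq.ge hω : k ≤ n ω)
  have hdesc : (k.descFactorial q : ℝ) ≤
      (θ / (b / 2) * q) ^ (θ * q) * Real.exp (b / 2 * (k : ℝ) ^ (1 / θ)) := by
    rw [div_mul_eq_mul_div]
    refine le_trans ?_ (natCast_pow_le_rpow_mul_exp hc hθ k (by omega))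
    exact_mod_cast Nat.descFactorial_le_pow k q
  refine (mul_le_mul hdesc hprob ENNReal.toReal_nonneg (by positivity)).trans (le_of_eq ?_)
  rw [mul_assoc, mul_left_comm (Real.exp _), ← Real.exp_add]
  ring_nf
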